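/- The plactic monoid M with three generators and the grammic monoid N2 with three generators are equationally equivalent: for every type X and all words w, w' ∈ FreeMonoid X, M satisfies the identity w ≍ w' if and only if N2 satisfies the identity w ≍ w'. -/

import Mathlib

namespace Plactic

/-- The generator `a`. -/
def a : FreeMonoid (Fin 3) := FreeMonoid.of 0
/-- The generator `b`. -/
def b : FreeMonoid (Fin 3) := FreeMonoid.of 1
/-- The generator `c`. -/
def c : FreeMonoid (Fin 3) := FreeMonoid.of 2

/-- The eight Knuth relations on three generators. -/
inductive KnuthRel : FreeMonoid (Fin 3) → FreeMonoid (Fin 3) → Prop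
  | aba : KnuthRel (a * b * a) (b * a * a)
  | bab : KnuthRel (b * a * b) (b * b * a)
  | aca : KnuthRel (a * c * a) (c * a * a)
  | cac : KnuthRel (c * a * c) (c * c * a)
  | cbb : KnuthRel (c * b * b) (b * c * b)
  | cbc : KnuthRel (c * b * c) (c * c * b)
  | bac : KnuthRel (b * a * c) (b * c * a)
  | acb : KnuthRel (a * c * b) (c * a * b)

/-- The plactic congruence: the congruence generated by the Knuth relations. -/
def placticCon : Con (FreeMonoid (Fin 3)) := conGen KnuthRel

/-- The plactic monoid with three generators. -/
abbrev M := placticCon.Quotient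

/-- The natural projection from the free monoid onto the plactic monoid. -/
def mk : FreeMonoid (Fin 3) →* M := placticCon.mk'

/-- The congruence on `M` generated by the pair `(ac, ca)`. -/
def con1 : Con M := conGen (fun x y => x = mk (a * c) ∧ y = mk (c * a))

/-- `N1 = M/(ac = ca)`. -/
abbrev N1 := con1.Quotient

/-- The congruence on `M` generated by the pair `(bacb, cbab)`. -/
def con2 : Con M := conGen (fun x y => x = mk (b * a * c * b) ∧ y = mk (c * b * a * b))

/-- The grammic monoid `N2 = M/(bacb = cbab)`. -/
abbrev N2 := con2.Quotient


/-- A monoid `S` satisfies the identity `w ≍ w'` if every monoid homomorphism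
from the free monoid into `S` equalizes `w` and `w'`. -/
def SatisfiesId (S : Type*) [Monoid S] {X : Type*} (w w' : FreeMonoid X) : Prop :=
  ∀ φ : FreeMonoid X →* S, φ w = φ w'

/-! ### Insertion lemmas in the plactic monoid -/

/-- Bundled Knuth relations for three elements of a monoid. -/
structure Kn {S : Type*} [Monoid S] (x y z : S) : Prop where
  aba : x * y * x = y * x * x
  bab : y * x * y = y * y * x
  aca : x * z * x = z * x * x
  cac : z * x * z = z * z * x
  cbb : z * y * y = y * z * y
  cbc : z * y * z = z * z * y
  bac : y * x * z = y * z * x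
  acb : x * z * y = z * x * y

section ins
variable {S : Type*} [Monoid S]

/-- `x x y = x y x` lets `y` jump left over a power of `x`. -/
lemma pow_jump_left {x y : S} (h : x * y * x = x * x * y) (n : ℕ) :
    x ^ (n + 1) * y = x * y * x ^ n := by
  induction n with
  | zero => simp
  | succ n ih =>
    rw [pow_succ' x (n + 1), mul_assoc, ih, pow_succ' x n]
    calc x * (x * y * x ^ n) = (x * x * y) * x ^ n := by simp only [mul_assoc]
      _ = _ := by rw [← h]; simp only [mul_assoc]

/-- `x y x = y x x` lets `y` jump left over a power of `x` followed by `x`. -/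
lemma pow_jump_right {x y : S} (h : x * y * x = y * x * x) (n : ℕ) :
    x ^ n * y * x = y * x ^ (n + 1) := by
  induction n with
  | zero => simp
  | succ n ih =>
    rw [pow_succ' x n]
    calc x * x ^ n * y * x = x * (x ^ n * y * x) := by simp only [mul_assoc]
      _ = (x * y * x) * x ^ n := by rw [ih, pow_succ']; simp only [mul_assoc]
      _ = y * x ^ (n + 1 + 1) := by rw [h, pow_succ', pow_succ']; simp only [mul_assoc]

/-- `a^n c b = c a^n b`. -/
lemma pow_acb {x y z : S} (k : Kn x y z) (n : ℕ) :
    x ^ n * z * y = z * x ^ n * y := by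
  cases n with
  | zero => simp
  | succ n =>
    calc x ^ (n + 1) * z * y = x ^ n * (x * z * y) := by rw [pow_succ]; simp only [mul_assoc]
      _ = (x ^ n * z * x) * y := by rw [k.acb]; simp only [mul_assoc]
      _ = _ := by rw [pow_jump_right k.aca]

/-- Insertion of `b` in a row `b^p c^(n+1)`. -/
lemma ins_b_row2 {x y z : S} (k : Kn x y z) (p n : ℕ) :
    y ^ p * z ^ (n + 1) * y = z * y ^ (p + 1) * z ^ n := by
  rw [mul_assoc, pow_jump_left k.cbc, ← pow_jump_right k.cbb.symm]
  simp only [mul_assoc]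

/-- Insertion of `b` in a row `a^α b^r c^(n+1)`. -/
lemma ins_b_row1 {x y z : S} (k : Kn x y z) (m r n : ℕ) :
    x ^ m * y ^ r * z ^ (n + 1) * y = z * (x ^ m * y ^ (r + 1) * z ^ n) := by
  calc x ^ m * y ^ r * z ^ (n + 1) * y = x ^ m * (y ^ r * z ^ (n + 1) * y) := by
        simp only [mul_assoc]
    _ = (x ^ m * z * y) * (y ^ r * z ^ n) := by
        rw [ins_b_row2 k, pow_succ']; simp only [mul_assoc]
    _ = _ := by rw [pow_acb k, pow_succ']; simp only [mul_assoc]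

/-- `b c^s a = b a c^s`. -/
lemma b_pow_a {x y z : S} (k : Kn x y z) (s : ℕ) : y * z ^ s * x = y * x * z ^ s := by
  cases s with
  | zero => simp
  | succ s =>
    rw [mul_assoc, pow_jump_left k.cac, ← mul_assoc, ← mul_assoc, ← k.bac, mul_assoc, ← pow_succ']

/-- Insertion of `a` in a row `a^α b^(n+1) c^s`. -/
lemma ins_a_row1 {x y z : S} (k : Kn x y z) (m n s : ℕ) :
    x ^ m * y ^ (n + 1) * z ^ s * x = y * (x ^ (m + 1) * y ^ n * z ^ s) := by
  calc x ^ m * y ^ (n + 1) * z ^ s * x = x ^ m * y ^ n * (y * z ^ s * x) := by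
        rw [pow_succ]; simp only [mul_assoc]
    _ = x ^ m * (y ^ (n + 1) * x) * z ^ s := by
        rw [b_pow_a k, pow_succ]; simp only [mul_assoc]
    _ = (x ^ m * y * x) * (y ^ n * z ^ s) := by
        rw [pow_jump_left k.bab]; simp only [mul_assoc]
    _ = _ := by rw [pow_jump_right k.aba]; simp only [mul_assoc]

/-- Insertion of `a` in a row `a^α c^(n+1)`. -/
lemma ins_a_row1_c {x y z : S} (k : Kn x y z) (m n : ℕ) :
    x ^ m * z ^ (n + 1) * x = z * (x ^ (m + 1) * z ^ n) := by
  rw [mul_assoc, pow_jump_left k.cac, ← mul_assoc, ← mul_assoc, pow_jump_right k.aca, mul_assoc]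

/-- The row reading of a tableau. -/
def nf (x y z : S) (i p q m r s : ℕ) : S :=
  z ^ i * (y ^ p * z ^ q) * (x ^ m * y ^ r * z ^ s)

/-- Being the row reading of some tableau. -/
def IsNf (x y z w : S) : Prop :=
  ∃ i p q m r s : ℕ, i ≤ p ∧ p ≤ m ∧ p + q ≤ m + r ∧ w = nf x y z i p q m r s

/-- Bumping a `b` into the second row. -/
lemma bump_b {x y z : S} (k : Kn x y z) (i p q : ℕ) :
    ∃ i' p' q', z ^ i * (y ^ p * z ^ q) * y = z ^ i' * (y ^ p' * z ^ q') ∧ p' = p + 1 ∧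
      ((q = 0 ∧ q' = 0 ∧ i' = i) ∨ (q = q' + 1 ∧ i' = i + 1)) := by
  cases q with
  | zero => exact ⟨i, p + 1, 0, by simp [pow_succ, mul_assoc], rfl, by simp⟩
  | succ q =>
    refine ⟨i + 1, p + 1, q, ?_, rfl, by simp⟩
    rw [mul_assoc, ins_b_row2 k, pow_succ z i]; simp only [mul_assoc]

lemma isNf_mul_c {x y z w : S} (h : IsNf x y z w) : IsNf x y z (w * z) := by
  obtain ⟨i, p, q, m, r, s, h1, h2, h3, rfl⟩ := h
  exact ⟨i, p, q, m, r, s + 1, h1, h2, h3, by simp only [nf, pow_succ, mul_assoc]⟩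

lemma isNf_mul_b {x y z w : S} (k : Kn x y z) (h : IsNf x y z w) : IsNf x y z (w * y) := by
  obtain ⟨i, p, q, m, r, s, h1, h2, h3, rfl⟩ := h
  cases s with
  | zero =>
    exact ⟨i, p, q, m, r + 1, 0, h1, h2, by omega, by simp [nf, pow_succ, mul_assoc]⟩
  | succ s =>
    refine ⟨i, p, q + 1, m, r + 1, s, h1, h2, by omega, ?_⟩
    rw [nf, mul_assoc, ins_b_row1 k, nf, pow_succ z q]; simp only [mul_assoc]

lemma isNf_mul_a {x y z w : S} (k : Kn x y z) (h : IsNf x y z w) : IsNf x y z (w * x) := by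
  obtain ⟨i, p, q, m, r, s, h1, h2, h3, rfl⟩ := h
  cases r with
  | succ r =>
    obtain ⟨i', p', q', e, hp, hq⟩ := bump_b k i p q
    refine ⟨i', p', q', m + 1, r, s, by omega, by omega, by omega, ?_⟩
    rw [nf, mul_assoc, ins_a_row1 k, ← mul_assoc, e, nf]
  | zero =>
    cases s with
    | zero =>
      exact ⟨i, p, q, m + 1, 0, 0, h1, by omega, by omega, by simp [nf, pow_succ, mul_assoc]⟩
    | succ s =>
      refine ⟨i, p, q + 1, m + 1, 0, s, h1, by omega, by omega, ?_⟩
      simp only [nf, pow_zero, mul_one]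
      rw [mul_assoc, ins_a_row1_c k, pow_succ z q]; simp only [mul_assoc]

end ins

lemma mk_eq {u v : FreeMonoid (Fin 3)} (h : KnuthRel u v) : mk u = mk v :=
  (Con.eq _).2 (ConGen.Rel.of _ _ h)

lemma kn_mk : Kn (mk a) (mk b) (mk c) := by
  constructor <;> simp only [← map_mul] <;> apply mk_eq <;> constructor

lemma isNf_mk (w : FreeMonoid (Fin 3)) : IsNf (mk a) (mk b) (mk c) (mk w) := by
  have key : ∀ l : List (Fin 3), IsNf (mk a) (mk b) (mk c) (mk (FreeMonoid.ofList l)) := by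
    intro l
    induction l using List.reverseRecOn with
    | nil => exact ⟨0, 0, 0, 0, 0, 0, le_rfl, le_rfl, le_rfl, by simp [nf]⟩
    | append_singleton l x ih =>
      rw [FreeMonoid.ofList_append, map_mul]
      fin_cases x
      · exact isNf_mul_a kn_mk ih
      · exact isNf_mul_b kn_mk ih
      · exact isNf_mul_c ih
  exact key w.toList

/-! ### The tropical action -/

/-- Triples of naturals, on which `N2` acts by tropical matrices. -/
abbrev V := ℕ × ℕ × ℕ

/-- Action of `a`. -/
def fa : Function.End V := fun v => (max v.1 (max v.2.1 v.2.2) + 1, max v.2.1 v.2.2, v.2.2)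
/-- Action of `b`. -/
def fb : Function.End V :=
  fun v => (max v.1 (max v.2.1 v.2.2 + 1), max v.2.1 v.2.2 + 1, v.2.2)
/-- Action of `c`. -/
def fc : Function.End V :=
  fun v => (max v.1 (max v.2.1 (v.2.2 + 1)), max v.2.1 (v.2.2 + 1), v.2.2 + 1)

/-- The action of the free monoid by tropical matrices. -/
def act : FreeMonoid (Fin 3) →* Function.End V := FreeMonoid.lift ![fa, fb, fc]

/-- The duality substitution `a ↦ ba`, `b ↦ ca`, `c ↦ cb`. -/
def theta : FreeMonoid (Fin 3) →* FreeMonoid (Fin 3) := FreeMonoid.lift ![b * a, c * a, c * b]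

@[simp] lemma act_a : act a = fa := by simp [act, a]
@[simp] lemma act_b : act b = fb := by simp [act, b]
@[simp] lemma act_c : act c = fc := by simp [act, c]
@[simp] lemma theta_a : theta a = b * a := by simp [theta, a]
@[simp] lemma theta_b : theta b = c * a := by simp [theta, b]
@[simp] lemma theta_c : theta c = c * b := by simp [theta, c]

lemma mul_app (f g : Function.End V) (v : V) : (f * g) v = f (g v) := rfl

lemma one_app (v : V) : (1 : Function.End V) v = v := rfl

lemma end_ext {f g : Function.End V} (h : ∀ x y z, f (x, y, z) = g (x, y, z)) : f = g :=
  funext fun v => h v.1 v.2.1 v.2.2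

lemma fa_app (x y z : ℕ) : fa (x, y, z) = (max x (max y z) + 1, max y z, z) := rfl
lemma fb_app (x y z : ℕ) : fb (x, y, z) = (max x (max y z + 1), max y z + 1, z) := rfl
lemma fc_app (x y z : ℕ) :
    fc (x, y, z) = (max x (max y (z + 1)), max y (z + 1), z + 1) := rfl

/-- Dual action of `a`. -/
def ga : Function.End V := fun v => (max v.1 (max v.2.1 v.2.2) + 1, max v.2.1 v.2.2 + 1, v.2.2)
/-- Dual action of `b`. -/
def gb : Function.End V :=
  fun v => (max v.1 (max v.2.1 v.2.2) + 1, max v.2.1 (v.2.2 + 1), v.2.2 + 1)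
/-- Dual action of `c`. -/
def gc : Function.End V :=
  fun v => (max v.1 (max v.2.1 v.2.2 + 1), max v.2.1 v.2.2 + 1, v.2.2 + 1)

lemma ga_app (x y z : ℕ) : ga (x, y, z) = (max x (max y z) + 1, max y z + 1, z) := rfl
lemma gb_app (x y z : ℕ) : gb (x, y, z) = (max x (max y z) + 1, max y (z + 1), z + 1) := rfl
lemma gc_app (x y z : ℕ) : gc (x, y, z) = (max x (max y z + 1), max y z + 1, z + 1) := rfl

lemma fb_fa : fb * fa = ga := by
  refine end_ext fun x y z => ?_
  simp only [mul_app, fa_app, fb_app, ga_app, Prod.mk.injEq]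
  refine ⟨?_, ?_, ?_⟩ <;> first | trivial | omega

lemma fc_fa : fc * fa = gb := by
  refine end_ext fun x y z => ?_
  simp only [mul_app, fa_app, fc_app, gb_app, Prod.mk.injEq]
  refine ⟨?_, ?_, ?_⟩ <;> first | trivial | omega

lemma fc_fb : fc * fb = gc := by
  refine end_ext fun x y z => ?_
  simp only [mul_app, fb_app, fc_app, gc_app, Prod.mk.injEq]
  refine ⟨?_, ?_, ?_⟩ <;> first | trivial | omega

lemma kn_act : Kn fa fb fc := by
  constructor <;> refine end_ext fun x y z => ?_ <;>
    simp only [mul_app, fa_app, fb_app, fc_app, Prod.mk.injEq] <;>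
    refine ⟨?_, ?_, ?_⟩ <;> first | trivial | omega

lemma kn_dual : Kn (fb * fa) (fc * fa) (fc * fb) := by
  rw [fb_fa, fc_fa, fc_fb]
  constructor <;> refine end_ext fun x y z => ?_ <;>
    simp only [mul_app, ga_app, gb_app, gc_app, Prod.mk.injEq] <;>
    refine ⟨?_, ?_, ?_⟩ <;> first | trivial | omega

lemma knuth_ker {S : Type*} [Monoid S] (f : FreeMonoid (Fin 3) →* S)
    (k : Kn (f a) (f b) (f c)) : placticCon ≤ Con.ker f := by
  refine Con.conGen_le.2 ?_
  intro u v h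
  rw [Con.ker_rel]
  cases h <;> simp only [map_mul]
  · exact k.aba
  · exact k.bab
  · exact k.aca
  · exact k.cac
  · exact k.cbb
  · exact k.cbc
  · exact k.bac
  · exact k.acb

/-- The action of the plactic monoid. -/
def actM : M →* Function.End V := placticCon.lift act (knuth_ker act (by simpa using kn_act))

/-- The dual action of the plactic monoid. -/
def dualM : M →* Function.End V :=
  placticCon.lift (act.comp theta) (knuth_ker _ (by simpa using kn_dual))

@[simp] lemma actM_mk (w : FreeMonoid (Fin 3)) : actM (mk w) = act w := rfl
@[simp] lemma dualM_mk (w : FreeMonoid (Fin 3)) : dualM (mk w) = act (theta w) := rfl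

lemma con2_le : con2 ≤ Con.ker actM := by
  refine Con.conGen_le.2 ?_
  rintro u v ⟨rfl, rfl⟩
  rw [Con.ker_rel]
  simp only [actM_mk, map_mul, act_a, act_b, act_c]
  refine end_ext fun x y z => ?_
  simp only [mul_app, fa_app, fb_app, fc_app, Prod.mk.injEq]
  refine ⟨?_, ?_, ?_⟩ <;> first | trivial | omega

/-! ### Evaluating the actions on normal forms -/

lemma fa_pow (n x y z : ℕ) (h1 : z ≤ y) (h2 : y ≤ x) : (fa ^ n) (x, y, z) = (x + n, y, z) := by
  induction n with
  | zero => rfl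
  | succ n ih =>
    rw [pow_succ', mul_app, ih]
    simp only [fa_app, Prod.mk.injEq]
    refine ⟨?_, ?_, ?_⟩ <;> first | trivial | omega

lemma fb_pow (n x y z : ℕ) (h1 : z ≤ y) (h2 : y ≤ x) :
    (fb ^ n) (x, y, z) = (max x (y + n), y + n, z) := by
  induction n with
  | zero => simp [one_app, h2]
  | succ n ih =>
    rw [pow_succ', mul_app, ih]
    simp only [fb_app, Prod.mk.injEq]
    refine ⟨?_, ?_, ?_⟩ <;> first | trivial | omega

lemma fc_pow (n x y z : ℕ) (h1 : z ≤ y) (h2 : y ≤ x) :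
    (fc ^ n) (x, y, z) = (max x (z + n), max y (z + n), z + n) := by
  induction n with
  | zero => simp [one_app, h1, h2, h1.trans h2]
  | succ n ih =>
    rw [pow_succ', mul_app, ih]
    simp only [fc_app, Prod.mk.injEq]
    refine ⟨?_, ?_, ?_⟩ <;> first | trivial | omega

lemma ga_pow (n x y z : ℕ) (h1 : z ≤ y) (h2 : y ≤ x) :
    (ga ^ n) (x, y, z) = (x + n, y + n, z) := by
  induction n with
  | zero => rfl
  | succ n ih =>
    rw [pow_succ', mul_app, ih]
    simp only [ga_app, Prod.mk.injEq]
    refine ⟨?_, ?_, ?_⟩ <;> first | trivial | omega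

lemma gb_pow (n x y z : ℕ) (h1 : z ≤ y) (h2 : y ≤ x) :
    (gb ^ n) (x, y, z) = (x + n, max y (z + n), z + n) := by
  induction n with
  | zero => simp [one_app, h1]
  | succ n ih =>
    rw [pow_succ', mul_app, ih]
    simp only [gb_app, Prod.mk.injEq]
    refine ⟨?_, ?_, ?_⟩ <;> first | trivial | omega

lemma gc_pow (n x y z : ℕ) (h1 : z ≤ y) (h2 : y ≤ x) :
    (gc ^ n) (x, y, z) = (max x (y + n), y + n, z + n) := by
  induction n with
  | zero => simp [one_app, h2]
  | succ n ih =>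
    rw [pow_succ', mul_app, ih]
    simp only [gc_app, Prod.mk.injEq]
    refine ⟨?_, ?_, ?_⟩ <;> first | trivial | omega

lemma nf_act (i p q m r s x y z : ℕ) (h1 : z ≤ y) (h2 : y ≤ x) :
    nf fa fb fc i p q m r s (x, y, z) =
      (fc ^ i) ((fb ^ p) ((fc ^ q) ((fa ^ m) ((fb ^ r) ((fc ^ s) (x, y, z)))))) := rfl

lemma nf_eval (i p q m r s x y z : ℕ) (h1 : z ≤ y) (h2 : y ≤ x) :
    ∃ A B C, nf fa fb fc i p q m r s (x, y, z) = (A, B, C) ∧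
      C = z + s + q + i ∧
      B = max (max (max (max y (z + s) + r) (z + s + q)) 0 + p) (z + s + q + i) ∧
      A = max (max (max (max (max x (z + s)) (max y (z + s) + r) + m) (z + s + q))
        (max (max y (z + s) + r) (z + s + q) + p)) (z + s + q + i) := by
  refine ⟨_, _, _, ?_, rfl, rfl, rfl⟩
  rw [nf_act _ _ _ _ _ _ _ _ _ h1 h2, fc_pow s, fb_pow r, fa_pow m, fc_pow q, fb_pow p, fc_pow i]
  · simp
  all_goals omega

lemma nf_dual_eval (i p q m r s : ℕ) (h1 : i ≤ p) (h2 : p ≤ m) :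
    (nf (fb * fa) (fc * fa) (fc * fb) i p q m r s (0, 0, 0)).1 = s + r + m + q + p := by
  rw [fb_fa, fc_fa, fc_fb]
  change ((gc ^ i) ((gb ^ p) ((gc ^ q) ((ga ^ m)
    ((gb ^ r) ((gc ^ s) (0, 0, 0))))))).1 = _
  rw [gc_pow s, gb_pow r, ga_pow m, gc_pow q, gb_pow p, gc_pow i]
  · simp only []
    omega
  all_goals omega

lemma map_nf {S T : Type*} [Monoid S] [Monoid T] (f : S →* T) (x y z : S) (i p q m r s : ℕ) :
    f (nf x y z i p q m r s) = nf (f x) (f y) (f z) i p q m r s := by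
  simp [nf]

/-- The two actions separate the elements of the plactic monoid. -/
lemma separate {u v : M} (h1 : actM u = actM v) (h2 : dualM u = dualM v) : u = v := by
  obtain ⟨u, rfl⟩ := placticCon.mk'_surjective u
  obtain ⟨v, rfl⟩ := placticCon.mk'_surjective v
  change mk u = mk v
  change actM (mk u) = actM (mk v) at h1
  change dualM (mk u) = dualM (mk v) at h2
  obtain ⟨i, p, q, m, r, s, a1, a2, a3, hu⟩ := isNf_mk u
  obtain ⟨i', p', q', m', r', s', b1, b2, b3, hv⟩ := isNf_mk v
  rw [hu, hv] at h1 h2 ⊢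
  simp only [map_nf, actM_mk, dualM_mk, act_a, act_b, act_c, theta_a, theta_b, theta_c,
    map_mul] at h1 h2
  have e0 := congrArg Prod.fst (congrFun h2 (0, 0, 0))
  rw [nf_dual_eval _ _ _ _ _ _ a1 a2, nf_dual_eval _ _ _ _ _ _ b1 b2] at e0
  obtain ⟨K, hK⟩ : ∃ K, K = i + p + q + m + r + s + i' + p' + q' + m' + r' + s' := ⟨_, rfl⟩
  have get : ∀ x y z, z ≤ y → y ≤ x → _ := fun x y z l1 l2 =>
    And.intro (nf_eval i p q m r s x y z l1 l2) (nf_eval i' p' q' m' r' s' x y z l1 l2)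
  simp only [h1] at get
  obtain ⟨⟨A, B, C, e1, e2, e3, e4⟩, ⟨A', B', C', e1', e2', e3', e4'⟩⟩ :=
    get 0 0 0 le_rfl le_rfl
  obtain ⟨⟨D, E, F, f1, f2, f3, f4⟩, ⟨D', E', F', f1', f2', f3', f4'⟩⟩ :=
    get K 0 0 le_rfl (Nat.zero_le _)
  obtain ⟨⟨G, H, I, g1, g2, g3, g4⟩, ⟨G', H', I', g1', g2', g3', g4'⟩⟩ :=
    get K K 0 (Nat.zero_le _) le_rfl
  rw [e1, Prod.mk.injEq, Prod.mk.injEq] at e1'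
  rw [f1, Prod.mk.injEq, Prod.mk.injEq] at f1'
  rw [g1, Prod.mk.injEq, Prod.mk.injEq] at g1'
  clear e1 f1 g1 h1 h2 hu hv get
  have hD : D = K + m := by clear * - f4 hK a1 a2 a3; omega
  have hD' : D' = K + m' := by clear * - f4' hK b1 b2 b3; omega
  have hm : m = m' := by omega
  have hG : G = K + m + r := by clear * - g4 hK a1 a2 a3; omega
  have hG' : G' = K + m' + r' := by clear * - g4' hK b1 b2 b3; omega
  have hr : r = r' := by omega
  have hH : H = K + r + p := by clear * - g3 hK a1 a2 a3; omega
  have hH' : H' = K + r' + p' := by clear * - g3' hK b1 b2 b3; omega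
  have hp : p = p' := by omega
  have hA : A = s + r + m := by clear * - e4 a1 a2 a3; omega
  have hA' : A' = s' + r' + m' := by clear * - e4' b1 b2 b3; omega
  have hs : s = s' := by omega
  have hq : q = q' := by omega
  have hi : i = i' := by omega
  rw [hm, hr, hp, hs, hq, hi]

/-- The plactic monoid `M` and the grammic monoid `N2` are equationally equivalent. -/
theorem M_equationally_equivalent_N2 :
    ∀ (X : Type*) (w w' : FreeMonoid X),
      SatisfiesId M w w' ↔ SatisfiesId N2 w w' := by
  intro X w w'
  constructor
  · intro h φ
    obtain ⟨ψ, rfl⟩ : ∃ ψ : FreeMonoid X →* M, con2.mk'.comp ψ = φ := by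
      choose g hg using con2.mk'_surjective
      exact ⟨FreeMonoid.lift fun x => g (φ (FreeMonoid.of x)),
        FreeMonoid.hom_eq fun x => by simpa using hg (φ (FreeMonoid.of x))⟩
    simp only [MonoidHom.comp_apply, h ψ]
  · intro h φ
    obtain ⟨ψ, rfl⟩ : ∃ ψ : FreeMonoid X →* FreeMonoid (Fin 3), mk.comp ψ = φ := by
      choose g hg using placticCon.mk'_surjective
      exact ⟨FreeMonoid.lift fun x => g (φ (FreeMonoid.of x)),
        FreeMonoid.hom_eq fun x => by simpa [mk] using hg (φ (FreeMonoid.of x))⟩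
    have key : ∀ χ : FreeMonoid X →* M, actM (χ w) = actM (χ w') := fun χ =>
      con2_le ((Con.eq _).1 (h (con2.mk'.comp χ)))
    exact separate (key (mk.comp ψ)) (key (mk.comp (theta.comp ψ)))

end Plactic
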